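/- arXiv:2305.00453 — 4 statements merged into one kernel-verified Lean document; each statement's English description precedes it below -/
import Mathlib

section
/- Let n ≥ 2 and 1 < q < n + 1. For every convex body Ω ⊂ ℝⁿ one has I_q(Ω) ≤ q·ω_n^{(1−q)/n}·Vol(Ω)^{(n+q−1)/n}, where Vol denotes Lebesgue measure. In particular, for every c₀ > 0, any convex body with I_q(Ω) ≥ c₀ satisfies Vol(Ω) ≥ (c₀·q^{-1}·ω_n^{(q−1)/n})^{n/(n+q−1)} > 0. -/
open MeasureTheory Metric

/-- `ω_n`, the volume of the unit ball of `ℝⁿ`. -/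
noncomputable def unitBallVol (n : ℕ) : ℝ :=
  (volume (closedBall (0 : EuclideanSpace ℝ (Fin n)) 1)).toReal

/-- The chord integral `I_q(Ω) = (q(q-1)/(n ω_n)) ∫_Ω ∫_Ω |y - z|^{q-1-n} dy dz` for `q > 1`. -/
noncomputable def chordIntegral (n : ℕ) (q : ℝ) (Ω : Set (EuclideanSpace ℝ (Fin n))) : ℝ :=
  (q * (q - 1) / ((n : ℝ) * unitBallVol n)) *
    ∫ z in Ω, ∫ y in Ω, ‖y - z‖ ^ (q - 1 - (n : ℝ))

section RadialIntegrals

open Module Set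

variable {E : Type*} [NormedAddCommGroup E] [NormedSpace ℝ E] [FiniteDimensional ℝ E] [Nontrivial E]

lemma pow_finrank_sub_one_mul_rpow {a r : ℝ} (hr : 0 < r) :
    r ^ (finrank ℝ E - 1) * r ^ a = r ^ (finrank ℝ E - 1 + a) := by
  have hd : 1 ≤ finrank ℝ E := finrank_pos
  rw [Real.rpow_add hr, ← Real.rpow_natCast, Nat.cast_sub hd, Nat.cast_one]

variable [MeasurableSpace E] [BorelSpace E] (μ : Measure E) [μ.IsAddHaarMeasure]

lemma integrableOn_ball_norm_rpow {a : ℝ} (ha : 0 < finrank ℝ E + a) (R : ℝ) :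
    IntegrableOn (fun x : E => ‖x‖ ^ a) (ball 0 R) μ := by
  rw [integrableOn_fun_norm_addHaar μ (f := fun r => r ^ a)]
  rcases le_or_gt R 0 with hR | hR
  · simp [Ioo_eq_empty_of_le hR]
  refine ((intervalIntegral.integrableOn_Ioo_rpow_iff (s := finrank ℝ E - 1 + a) hR).2
    (by linarith)).congr_fun (fun r hr => ?_) measurableSet_Ioo
  exact (pow_finrank_sub_one_mul_rpow hr.1).symm

lemma setIntegral_ball_norm_rpow {a : ℝ} (ha : 0 < finrank ℝ E + a) {R : ℝ} (hR : 0 ≤ R) :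
    ∫ x in ball (0 : E) R, ‖x‖ ^ a ∂μ =
      finrank ℝ E * μ.real (ball 0 1) * (R ^ (finrank ℝ E + a) / (finrank ℝ E + a)) := by
  have h_radial : ∫ x in ball (0 : E) R, ‖x‖ ^ a ∂μ =
      ∫ x : E, (Iio R).indicator (fun r : ℝ => r ^ a) ‖x‖ ∂μ := by
    rw [← integral_indicator measurableSet_ball]
    congr 1 with x
    simp [indicator]
  have h_line : ∫ r in Ioi (0 : ℝ),
      r ^ (finrank ℝ E - 1) • (Iio R).indicator (fun r : ℝ => r ^ a) r =
      ∫ r in (0 : ℝ)..R, r ^ (finrank ℝ E - 1 + a) := by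
    rw [intervalIntegral.integral_of_le hR, integral_Ioc_eq_integral_Ioo,
      ← Ioi_inter_Iio, ← setIntegral_indicator measurableSet_Iio]
    refine setIntegral_congr_fun measurableSet_Ioi fun r hr => ?_
    by_cases h : r ∈ Iio R
    · simpa [indicator_of_mem h] using pow_finrank_sub_one_mul_rpow (E := E) (a := a) hr
    · simp [indicator_of_notMem h]
  rw [h_radial, integral_fun_norm_addHaar, h_line, integral_rpow (Or.inl (by linarith)),
    show (finrank ℝ E : ℝ) - 1 + a + 1 = finrank ℝ E + a by ring, Real.zero_rpow ha.ne',
    sub_zero, nsmul_eq_mul, smul_eq_mul, mul_assoc]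

/-- Among sets of given measure, the centred ball maximises the integral of a negative power of
the norm. -/
lemma setIntegral_norm_rpow_le_setIntegral_ball {a : ℝ} (ha : 0 < finrank ℝ E + a) (ha' : a < 0)
    {R : ℝ} (hR : 0 < R) {s : Set E} (hs : MeasurableSet s) (hs' : μ s ≠ ⊤)
    (h : μ.real s = μ.real (ball (0 : E) R)) :
    ∫ x in s, ‖x‖ ^ a ∂μ ≤ ∫ x in ball (0 : E) R, ‖x‖ ^ a ∂μ := by
  have hB := integrableOn_ball_norm_rpow μ ha R
  have hcB : IntegrableOn (fun _ : E => R ^ a) (ball 0 R) μ :=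
    integrableOn_const measure_ball_lt_top.ne
  have hcs : IntegrableOn (fun _ : E => R ^ a) s μ := integrableOn_const hs'
  have h_out (x : E) (hx : x ∉ ball (0 : E) R) : ‖x‖ ^ a ≤ R ^ a :=
    Real.rpow_le_rpow_of_nonpos hR (by simpa using hx) ha'.le
  have hsi : IntegrableOn (fun x : E => ‖x‖ ^ a) s μ := by
    rw [← inter_union_sdiff s (ball 0 R)]
    refine (hB.mono_set inter_subset_right).union
      ((hcs.mono_set sdiff_subset).mono'
        (measurable_norm.pow_const a).aestronglyMeasurable ?_)
    filter_upwards [ae_restrict_mem (hs.diff measurableSet_ball)] with x hx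
    rw [Real.norm_of_nonneg (by positivity)]
    exact h_out x hx.2
  have key : ∫ x in s, (‖x‖ ^ a - R ^ a) ∂μ ≤ ∫ x in ball (0 : E) R, (‖x‖ ^ a - R ^ a) ∂μ := by
    rw [← integral_indicator hs, ← integral_indicator measurableSet_ball]
    refine integral_mono_ae ((hsi.sub hcs).integrable_indicator hs)
      ((hB.sub hcB).integrable_indicator measurableSet_ball) ?_
    filter_upwards [compl_mem_ae_iff.2 (measure_singleton (μ := μ) (0 : E))] with x hx
    by_cases hxB : x ∈ ball (0 : E) R
    · have : R ^ a ≤ ‖x‖ ^ a :=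
        Real.rpow_le_rpow_of_nonpos (norm_pos_iff.2 hx) (mem_ball_zero_iff.1 hxB).le ha'.le
      rw [indicator_of_mem hxB]
      exact indicator_le_self' (fun _ _ => sub_nonneg.2 this) x
    · rw [indicator_of_notMem hxB]
      exact indicator_apply_le' (fun _ => sub_nonpos.2 (h_out x hxB)) fun _ => le_rfl
  rw [integral_sub hsi hcs, integral_sub hB hcB, setIntegral_const, setIntegral_const, h] at key
  linarith

end RadialIntegrals

lemma unitBallVol_pos (n : ℕ) : 0 < unitBallVol n :=
  ENNReal.toReal_pos (measure_closedBall_pos _ _ one_pos).ne' measure_closedBall_lt_top.ne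

lemma setIntegral_norm_sub_rpow_le {n : ℕ} (hn : n ≠ 0) {q : ℝ} (hq1 : 1 < q)
    (hq2 : q < (n : ℝ) + 1) {Ω : Set (EuclideanSpace ℝ (Fin n))} (hΩ : MeasurableSet Ω)
    (hpos : 0 < (volume Ω).toReal) (z : EuclideanSpace ℝ (Fin n)) :
    ∫ y in Ω, ‖y - z‖ ^ (q - 1 - (n : ℝ)) ≤
      n * unitBallVol n *
        (((volume Ω).toReal / unitBallVol n) ^ ((q - 1) / (n : ℝ)) / (q - 1)) := by
  have : NeZero n := ⟨hn⟩
  have hn' : (n : ℝ) ≠ 0 := by exact_mod_cast hn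
  have hω := unitBallVol_pos n
  have hball : unitBallVol n = volume.real (ball (0 : EuclideanSpace ℝ (Fin n)) 1) :=
    Measure.addHaar_real_closedBall_eq_addHaar_real_ball _ _ _
  set R : ℝ := ((volume Ω).toReal / unitBallVol n) ^ (1 / (n : ℝ)) with hR_def
  have hR : 0 < R := by positivity
  have hRn : R ^ n = (volume Ω).toReal / unitBallVol n := by
    rw [hR_def, ← Real.rpow_mul_natCast (by positivity), one_div_mul_cancel hn', Real.rpow_one]
  have h_pre : MeasurePreserving (fun y => y - z)
      (volume : Measure (EuclideanSpace ℝ (Fin n))) volume := measurePreserving_sub_right _ z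
  have h_emb : MeasurableEmbedding (fun y : EuclideanSpace ℝ (Fin n) => y - z) :=
    measurableEmbedding_subRight z
  have h_vol : volume ((fun y => y - z) '' Ω) = volume Ω := by
    rw [← h_pre.measure_preimage_emb h_emb, h_emb.injective.preimage_image]
  have h_translate : ∫ y in Ω, ‖y - z‖ ^ (q - 1 - (n : ℝ)) =
      ∫ x in (fun y => y - z) '' Ω, ‖x‖ ^ (q - 1 - (n : ℝ)) := by
    rw [h_pre.setIntegral_image_emb h_emb (fun x => ‖x‖ ^ (q - 1 - (n : ℝ)))]
  have hd : (Module.finrank ℝ (EuclideanSpace ℝ (Fin n)) : ℝ) + (q - 1 - n) = q - 1 := by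
    simp
  rw [h_translate]
  refine (setIntegral_norm_rpow_le_setIntegral_ball volume (R := R) (by rw [hd]; linarith)
    (by linarith) hR (h_emb.measurableSet_image.2 hΩ) ?_ ?_).trans_eq ?_
  · rw [h_vol]
    exact (ENNReal.toReal_pos_iff.1 hpos).2.ne
  · rw [measureReal_def, measureReal_def, h_vol, Measure.addHaar_ball _ _ hR.le,
      ENNReal.toReal_mul, ENNReal.toReal_ofReal (by positivity), ← measureReal_def _ (ball 0 1), ← hball,
      finrank_euclideanSpace_fin, hRn, div_mul_cancel₀ _ hω.ne']
  · rw [setIntegral_ball_norm_rpow _ (by rw [hd]; linarith) hR.le, hd, ← hball,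
      finrank_euclideanSpace_fin, hR_def, ← Real.rpow_mul (by positivity), one_div_mul_eq_div]

lemma chordIntegral_le {n : ℕ} (hn : n ≠ 0) {q : ℝ} (hq1 : 1 < q)
    (hq2 : q < (n : ℝ) + 1) {Ω : Set (EuclideanSpace ℝ (Fin n))} (hΩ : MeasurableSet Ω)
    (hpos : 0 < (volume Ω).toReal) :
    chordIntegral n q Ω ≤ q * unitBallVol n ^ ((1 - q) / (n : ℝ)) *
      (volume Ω).toReal ^ (((n : ℝ) + q - 1) / (n : ℝ)) := by
  have hn' : (0 : ℝ) < n := by exact_mod_cast Nat.pos_of_ne_zero hn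
  have hω := unitBallVol_pos n
  have hq : 0 < q - 1 := sub_pos.2 hq1
  have h_outer := (Real.le_norm_self _).trans
    (norm_setIntegral_le_of_norm_le_const (ENNReal.toReal_pos_iff.1 hpos).2 fun z _ =>
      (Real.norm_of_nonneg (integral_nonneg fun _ => by positivity)).trans_le
        (setIntegral_norm_sub_rpow_le hn hq1 hq2 hΩ hpos z))
  rw [measureReal_def] at h_outer
  refine (mul_le_mul_of_nonneg_left h_outer (by positivity)).trans_eq ?_
  rw [show ((n : ℝ) + q - 1) / n = 1 + (q - 1) / n by field_simp; ring, Real.rpow_add hpos,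
    Real.rpow_one, show (1 - q) / (n : ℝ) = -((q - 1) / n) by ring, Real.rpow_neg hω.le,
    Real.div_rpow hpos.le hω.le]
  field_simp

theorem stmt_1 {n : ℕ} (hn : 2 ≤ n) (q : ℝ) (hq1 : 1 < q) (hq2 : q < (n : ℝ) + 1) :
    (∀ Ω : Set (EuclideanSpace ℝ (Fin n)),
      IsCompact Ω → Convex ℝ Ω → (interior Ω).Nonempty →
      chordIntegral n q Ω
        ≤ q * unitBallVol n ^ ((1 - q) / (n : ℝ)) *
            (volume Ω).toReal ^ (((n : ℝ) + q - 1) / (n : ℝ))) ∧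
    (∀ c₀ : ℝ, 0 < c₀ →
      ∀ Ω : Set (EuclideanSpace ℝ (Fin n)),
        IsCompact Ω → Convex ℝ Ω → (interior Ω).Nonempty →
        c₀ ≤ chordIntegral n q Ω →
        (c₀ * q⁻¹ * unitBallVol n ^ ((q - 1) / (n : ℝ))) ^ ((n : ℝ) / ((n : ℝ) + q - 1))
            ≤ (volume Ω).toReal ∧
        0 < (c₀ * q⁻¹ * unitBallVol n ^ ((q - 1) / (n : ℝ))) ^ ((n : ℝ) / ((n : ℝ) + q - 1))) := by
  have h_pos {Ω : Set (EuclideanSpace ℝ (Fin n))} (hΩ : IsCompact Ω)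
      (hi : (interior Ω).Nonempty) : 0 < (volume Ω).toReal :=
    ENNReal.toReal_pos (Measure.measure_pos_of_nonempty_interior _ hi).ne' hΩ.measure_lt_top.ne
  have h_le {Ω : Set (EuclideanSpace ℝ (Fin n))} (hΩ : IsCompact Ω)
      (hi : (interior Ω).Nonempty) :=
    chordIntegral_le (by omega) hq1 hq2 hΩ.measurableSet (h_pos hΩ hi)
  refine ⟨fun Ω hΩ _ hi => h_le hΩ hi, fun c₀ hc Ω hΩ _ hi hcI => ?_⟩
  have hω := unitBallVol_pos n
  have hn' : (0 : ℝ) < n := by exact_mod_cast (by omega : 0 < n)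
  have hm : 0 < (n : ℝ) + q - 1 := by linarith
  have hV := h_pos hΩ hi
  refine ⟨?_, by positivity⟩
  have h_base : c₀ * q⁻¹ * unitBallVol n ^ ((q - 1) / (n : ℝ)) ≤
      (volume Ω).toReal ^ (((n : ℝ) + q - 1) / (n : ℝ)) := by
    have h := hcI.trans (h_le hΩ hi)
    rw [show (1 - q) / (n : ℝ) = -((q - 1) / n) by ring, Real.rpow_neg hω.le] at h
    field_simp at h ⊢
    linarith
  refine (Real.rpow_le_rpow (by positivity) h_base (by positivity)).trans_eq ?_
  rw [← Real.rpow_mul hV.le, div_mul_div_cancel₀ hn'.ne', div_self hm.ne', Real.rpow_one]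
end

section
/- Let n ≥ 2, p > 0 and q > 1. Let f : S^{n-1} → ℝ be continuous, positive and even, and let c₀ > 0, M > 0. Then there exists a constant C ≥ 1, depending only on n, p, q, f, c₀, M, such that every origin-symmetric convex body Ω ⊂ ℝⁿ satisfying I_q(Ω) ≥ c₀ and ∫_{S^{n-1}} f(x)·h_Ω(x)^p dH^{n-1}(x) ≤ M satisfies 1/C ≤ h_Ω(x) ≤ C for all x ∈ S^{n-1}. -/
open MeasureTheory Metric
open scoped RealInnerProductSpace

/-- The support function `h_Ω(x) = max {x ⬝ y : y ∈ Ω}`. -/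
noncomputable def suppFn {n : ℕ} (Ω : Set (EuclideanSpace ℝ (Fin n)))
    (x : EuclideanSpace ℝ (Fin n)) : ℝ :=
  sSup ((fun y => ⟪x, y⟫) '' Ω)

open Module in
/-- A closed hemisphere has finite `(n-1)`-dimensional Hausdorff measure. -/
lemma hausdorffMeasure_hemisphere_lt_top {n : ℕ} (hn : 2 ≤ n) {v : EuclideanSpace ℝ (Fin n)}
    (hv : ‖v‖ = 1) :
    μH[(n : ℝ) - 1] {x : EuclideanSpace ℝ (Fin n) | x ∈ sphere 0 1 ∧ ⟪v, x⟫ ≤ 0} < ⊤ := by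
  have hv0 : v ≠ 0 := fun h => by simp [h] at hv
  have hfin : finrank ℝ (ℝ ∙ v)ᗮ = n - 1 := by
    have : Fact (finrank ℝ (EuclideanSpace ℝ (Fin n)) = (n - 1) + 1) := ⟨by simp; omega⟩
    exact Submodule.finrank_orthogonal_span_singleton hv0
  have hcast : ((finrank ℝ (ℝ ∙ v)ᗮ : ℕ) : ℝ) = (n : ℝ) - 1 := by
    rw [hfin, Nat.cast_sub (by omega)]; simp
  have hsub : {x : EuclideanSpace ℝ (Fin n) | x ∈ sphere 0 1 ∧ ⟪v, x⟫ ≤ 0} ⊆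
      (fun w : (ℝ ∙ v)ᗮ => stereoInvFunAux v w) '' closedBall 0 2 := by
    rintro x ⟨hx, hvx⟩
    have hxv : x ≠ v := by
      rintro rfl
      rw [real_inner_self_eq_norm_sq, hv] at hvx
      norm_num at hvx
    refine ⟨stereoToFun v x, ?_, congrArg Subtype.val (stereo_left_inv hv (x := ⟨x, hx⟩) hxv)⟩
    rw [mem_closedBall_zero_iff, stereoToFun_apply, norm_smul, innerSL_apply_apply]
    have h1 : ‖(ℝ ∙ v)ᗮ.orthogonalProjectionOnto x‖ ≤ 1 :=
      ((ℝ ∙ v)ᗮ.norm_orthogonalProjectionOnto_apply_le x).trans (mem_sphere_zero_iff_norm.1 hx).le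
    have h2 : ‖2 / (1 - ⟪v, x⟫)‖ ≤ 2 := by
      rw [Real.norm_of_nonneg (div_nonneg zero_le_two (by linarith)), div_le_iff₀ (by linarith)]
      linarith
    calc _ ≤ (2 : ℝ) * 1 := mul_le_mul h2 h1 (norm_nonneg _) zero_le_two
      _ = 2 := mul_one 2
  have hdiff : ContDiff ℝ 1 (fun w : (ℝ ∙ v)ᗮ => stereoInvFunAux v w) :=
    contDiff_stereoInvFunAux.comp (ℝ ∙ v)ᗮ.subtypeL.contDiff
  obtain ⟨K, hK⟩ := hdiff.contDiffOn.exists_lipschitzOnWith one_ne_zero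
    (convex_closedBall (0 : (ℝ ∙ v)ᗮ) 2) (isCompact_closedBall _ _)
  refine (measure_mono hsub).trans_lt
    ((hK.hausdorffMeasure_image_le (d := (n : ℝ) - 1) (hcast ▸ Nat.cast_nonneg _)).trans_lt ?_)
  rw [← hcast]
  exact ENNReal.mul_lt_top (ENNReal.rpow_lt_top_of_nonneg (Nat.cast_nonneg _) ENNReal.coe_ne_top)
    (isCompact_closedBall _ _).measure_lt_top

lemma hausdorffMeasure_sphere_lt_top {n : ℕ} (hn : 2 ≤ n) :
    μH[(n : ℝ) - 1] (sphere (0 : EuclideanSpace ℝ (Fin n)) 1) < ⊤ := by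
  have : Nonempty (Fin n) := ⟨⟨0, by omega⟩⟩
  obtain ⟨v, hv⟩ := exists_norm_eq (EuclideanSpace ℝ (Fin n)) zero_le_one
  refine (measure_mono (t := {x | x ∈ sphere 0 1 ∧ ⟪v, x⟫ ≤ 0} ∪
    {x | x ∈ sphere 0 1 ∧ ⟪-v, x⟫ ≤ 0}) fun x hx => ?_).trans_lt
    ((measure_union_le _ _).trans_lt (ENNReal.add_lt_top.2
      ⟨hausdorffMeasure_hemisphere_lt_top hn hv,
        hausdorffMeasure_hemisphere_lt_top hn ((norm_neg v).trans hv)⟩))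
  rcases le_total ⟪v, x⟫ 0 with h | h
  · exact Or.inl ⟨hx, h⟩
  · exact Or.inr ⟨hx, by rw [inner_neg_left]; linarith⟩

open Module in
/-- The caps of angular radius `π / 3` have Hausdorff measure bounded below, uniformly in their
centre. -/
lemma exists_pos_le_hausdorffMeasure_cap {n : ℕ} (hn : 2 ≤ n) :
    ∃ κ : ENNReal, 0 < κ ∧ ∀ u : EuclideanSpace ℝ (Fin n), ‖u‖ = 1 →
      κ ≤ μH[(n : ℝ) - 1] {x : EuclideanSpace ℝ (Fin n) | x ∈ sphere 0 1 ∧ 1 / 2 ≤ ⟪u, x⟫} := by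
  have hcast : ((finrank ℝ (EuclideanSpace ℝ (Fin (n - 1))) : ℕ) : ℝ) = (n : ℝ) - 1 := by
    rw [finrank_euclideanSpace_fin, Nat.cast_sub (by omega)]; simp
  refine ⟨μH[(n : ℝ) - 1] (ball (0 : EuclideanSpace ℝ (Fin (n - 1))) (1 / 2)), ?_, ?_⟩
  · rw [← hcast]
    exact measure_ball_pos _ _ (by norm_num)
  intro u hu
  have hu0 : u ≠ 0 := fun h => by simp [h] at hu
  have hfin : finrank ℝ (ℝ ∙ u)ᗮ = n - 1 := by
    have : Fact (finrank ℝ (EuclideanSpace ℝ (Fin n)) = (n - 1) + 1) := ⟨by simp; omega⟩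
    exact Submodule.finrank_orthogonal_span_singleton hu0
  let e : (ℝ ∙ u)ᗮ ≃ₗᵢ[ℝ] EuclideanSpace ℝ (Fin (n - 1)) :=
    ((stdOrthonormalBasis ℝ (ℝ ∙ u)ᗮ).reindex (finCongr hfin)).repr
  have hL : LipschitzWith 1 (fun x => e ((ℝ ∙ u)ᗮ.orthogonalProjectionOnto x)) :=
    mul_one (1 : NNReal) ▸ e.lipschitz.comp (ℝ ∙ u)ᗮ.lipschitzWith_orthogonalProjectionOnto
  have hsub : ball (0 : EuclideanSpace ℝ (Fin (n - 1))) (1 / 2) ⊆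
      (fun x => e ((ℝ ∙ u)ᗮ.orthogonalProjectionOnto x)) ''
        {x : EuclideanSpace ℝ (Fin n) | x ∈ sphere 0 1 ∧ 1 / 2 ≤ ⟪u, x⟫} := by
    intro w hw
    rw [mem_ball_zero_iff] at hw
    set v : (ℝ ∙ u)ᗮ := e.symm w with hv
    have hvw : ‖(v : EuclideanSpace ℝ (Fin n))‖ = ‖w‖ := by
      rw [Submodule.norm_coe, hv, e.symm.norm_map]
    have huv : ⟪u, (v : EuclideanSpace ℝ (Fin n))⟫ = 0 :=
      Submodule.mem_orthogonal_singleton_iff_inner_right.mp v.2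
    have hsq : ‖w‖ ^ 2 ≤ 1 / 4 := by nlinarith [norm_nonneg w]
    refine ⟨v + √(1 - ‖w‖ ^ 2) • u, ⟨?_, ?_⟩, ?_⟩
    · rw [mem_sphere_zero_iff_norm, ← sq_eq_sq₀ (norm_nonneg _) zero_le_one,
        norm_add_sq_real, inner_smul_right, real_inner_comm, huv, norm_smul, hu, hvw, mul_one,
        Real.norm_eq_abs, sq_abs, Real.sq_sqrt (by linarith)]
      ring
    · rw [inner_add_right, huv, inner_smul_right, real_inner_self_eq_norm_sq, hu]
      have : 1 / 2 ≤ √(1 - ‖w‖ ^ 2) := Real.le_sqrt_of_sq_le (by linarith)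
      linarith
    · simp [hv, Submodule.orthogonalProjectionOnto_orthogonalComplement_singleton_eq_zero]
  have := hL.hausdorffMeasure_image_le (d := (n : ℝ) - 1) (hcast ▸ Nat.cast_nonneg _)
    {x : EuclideanSpace ℝ (Fin n) | x ∈ sphere 0 1 ∧ 1 / 2 ≤ ⟪u, x⟫}
  simp only [ENNReal.coe_one, ENNReal.one_rpow, one_mul] at this
  exact (measure_mono hsub).trans this

/-- The part of the ball of radius `R` in a slab of half-width `δ` has volume at most that of a
box of the same dimensions. -/
lemma volume_real_slab_le {n : ℕ} (hn : 1 ≤ n) {x : EuclideanSpace ℝ (Fin n)} (hx : ‖x‖ = 1)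
    {δ R : ℝ} (hδ : 0 ≤ δ) (hR : 0 ≤ R) {s : Set (EuclideanSpace ℝ (Fin n))}
    (hs : ∀ y ∈ s, ‖y‖ ≤ R ∧ |⟪x, y⟫| ≤ δ) :
    volume.real s ≤ 2 * δ * (2 * R) ^ (n - 1) := by
  let i₀ : Fin n := ⟨0, by omega⟩
  have hort : Orthonormal ℝ (({i₀} : Set (Fin n)).domRestrict fun _ => x) := by
    refine ⟨fun _ => hx, fun i j hij => absurd (Subsingleton.elim i j) hij⟩
  obtain ⟨b, hb⟩ := hort.exists_orthonormalBasis_extension_of_card_eq (by simp)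
  have hb₀ : b i₀ = x := hb i₀ rfl
  let a : Fin n → ℝ := fun i => if i = i₀ then δ else R
  have hmp := (PiLp.volume_preserving_ofLp (Fin n)).comp b.measurePreserving_repr
  have hsub : s ⊆ (WithLp.ofLp ∘ b.repr) ⁻¹' Set.univ.pi fun i => Set.Icc (-a i) (a i) := by
    intro y hy i _
    refine abs_le.1 ?_
    change |b.repr y i| ≤ a i
    rw [b.repr_apply_apply]
    by_cases hi : i = i₀
    · simpa [a, hi, hb₀] using (hs y hy).2
    · simp only [a, hi, if_false]
      calc |⟪b i, y⟫| ≤ ‖b i‖ * ‖y‖ := abs_real_inner_le_norm _ _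
        _ ≤ R := by simpa using (hs y hy).1
  have hvol : volume ((WithLp.ofLp ∘ b.repr) ⁻¹' Set.univ.pi fun i => Set.Icc (-a i) (a i)) =
      ENNReal.ofReal (2 * δ * (2 * R) ^ (n - 1)) := by
    rw [hmp.measure_preimage
      (MeasurableSet.univ_pi fun i => measurableSet_Icc).nullMeasurableSet, volume_pi_pi]
    simp only [Real.volume_Icc]
    rw [← ENNReal.ofReal_prod_of_nonneg fun i _ => by simp only [a]; split_ifs <;> linarith]
    congr 1
    rw [← Finset.mul_prod_erase _ _ (Finset.mem_univ i₀)]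
    rw [Finset.prod_congr rfl (g := fun _ => 2 * R) fun i hi => by
      simp only [a, Finset.ne_of_mem_erase hi, if_false]; ring]
    simp only [a, if_true, Finset.prod_const, Finset.card_erase_of_mem (Finset.mem_univ i₀),
      Finset.card_univ, Fintype.card_fin]
    ring
  refine ENNReal.toReal_le_of_le_ofReal (by positivity) ?_
  exact (measure_mono hsub).trans hvol.le

/-- The chord integral of a set contained in a ball is controlled by its volume. -/
lemma exists_chordIntegral_le_mul_volume {n : ℕ} (hn : 1 ≤ n) {q : ℝ} (hq : 1 < q) (R : ℝ) :
    ∃ K : ℝ, 0 ≤ K ∧ ∀ s : Set (EuclideanSpace ℝ (Fin n)), s ⊆ closedBall 0 R →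
      chordIntegral n q s ≤ K * volume.real s := by
  have hint : LocallyIntegrable (fun w : EuclideanSpace ℝ (Fin n) => ‖w‖ ^ (q - 1 - (n : ℝ))) :=
    locallyIntegrable_of_norm_le_rpow (C := 1) (α := n + 1 - q) (by simpa using hn)
      (by simp; linarith)
      (Filter.Eventually.of_forall fun x => by
        rw [Real.norm_of_nonneg (by positivity), one_mul]
        exact (congrArg (‖x‖ ^ ·) (by ring)).le)
      (measurable_norm.pow_const _).aestronglyMeasurable
  let J := ∫ w in closedBall (0 : EuclideanSpace ℝ (Fin n)) (2 * R), ‖w‖ ^ (q - 1 - (n : ℝ))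
  let A := q * (q - 1) / ((n : ℝ) * unitBallVol n)
  have hJ : 0 ≤ J := integral_nonneg fun w => by positivity
  have hA : 0 ≤ A := div_nonneg (mul_nonneg (by linarith) (by linarith))
    (mul_nonneg (Nat.cast_nonneg _) ENNReal.toReal_nonneg)
  refine ⟨A * J, mul_nonneg hA hJ, fun s hs => ?_⟩
  have hinner : ∀ z ∈ s, ‖∫ y in s, ‖y - z‖ ^ (q - 1 - (n : ℝ))‖ ≤ J := by
    intro z hz
    rw [Real.norm_of_nonneg (integral_nonneg fun w => by positivity)]
    have hmp := measurePreserving_sub_right (volume : Measure (EuclideanSpace ℝ (Fin n))) z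
    have hemb : MeasurableEmbedding fun y : EuclideanSpace ℝ (Fin n) => y - z :=
      (MeasurableEquiv.subRight z).measurableEmbedding
    have hpre := hmp.setIntegral_preimage_emb hemb (fun w => ‖w‖ ^ (q - 1 - (n : ℝ)))
      (closedBall 0 (2 * R))
    rw [show J = _ from hpre.symm]
    refine setIntegral_mono_set ?_ (Filter.Eventually.of_forall fun w => by positivity)
      (Filter.Eventually.of_forall fun y hy => ?_)
    · exact (hmp.integrableOn_comp_preimage hemb).2
        (hint.integrableOn_isCompact (isCompact_closedBall _ _))
    · have h1 := mem_closedBall_zero_iff.1 (hs hz)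
      have h2 := mem_closedBall_zero_iff.1 (hs hy)
      exact mem_closedBall_zero_iff.2 ((norm_sub_le y z).trans (by linarith))
  have hfin : volume s < ⊤ := (measure_mono hs).trans_lt measure_closedBall_lt_top
  have h := (Real.le_norm_self _).trans (norm_setIntegral_le_of_norm_le_const hfin hinner)
  calc chordIntegral n q s ≤ A * (J * volume.real s) := mul_le_mul_of_nonneg_left h hA
    _ = A * J * volume.real s := (mul_assoc _ _ _).symm

lemma inner_le_suppFn {n : ℕ} {Ω : Set (EuclideanSpace ℝ (Fin n))} (hΩ : IsCompact Ω)
    (x : EuclideanSpace ℝ (Fin n)) {y : EuclideanSpace ℝ (Fin n)} (hy : y ∈ Ω) :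
    ⟪x, y⟫ ≤ suppFn Ω x :=
  le_csSup (hΩ.image (by fun_prop)).bddAbove ⟨y, hy, rfl⟩

lemma suppFn_le {n : ℕ} {Ω : Set (EuclideanSpace ℝ (Fin n))} (hne : Ω.Nonempty)
    {x : EuclideanSpace ℝ (Fin n)} {c : ℝ} (h : ∀ y ∈ Ω, ⟪x, y⟫ ≤ c) : suppFn Ω x ≤ c :=
  csSup_le (hne.image _) (by rintro _ ⟨y, hy, rfl⟩; exact h y hy)

lemma continuous_suppFn {n : ℕ} {Ω : Set (EuclideanSpace ℝ (Fin n))} (hΩ : IsCompact Ω) :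
    Continuous (suppFn Ω) :=
  hΩ.continuous_sSup (f := fun x y : EuclideanSpace ℝ (Fin n) => ⟪x, y⟫)
    (by fun_prop)

/-- A weighted `L^p` bound on the support function over the sphere bounds the body. -/
lemma exists_norm_le_of_setIntegral_suppFn_le {n : ℕ} (hn : 2 ≤ n) {p : ℝ} (hp : 0 < p)
    {f : EuclideanSpace ℝ (Fin n) → ℝ}
    (hf_cont : ContinuousOn f (sphere (0 : EuclideanSpace ℝ (Fin n)) 1))
    (hf_pos : ∀ x ∈ sphere (0 : EuclideanSpace ℝ (Fin n)) 1, 0 < f x) (M : ℝ) :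
    ∃ R : ℝ, 0 < R ∧ ∀ Ω : Set (EuclideanSpace ℝ (Fin n)), IsCompact Ω → 0 ∈ Ω →
      (∫ x in sphere (0 : EuclideanSpace ℝ (Fin n)) 1,
        f x * suppFn Ω x ^ p ∂(μH[(n : ℝ) - 1])) ≤ M → ∀ y ∈ Ω, ‖y‖ ≤ R := by
  have : Nonempty (Fin n) := ⟨⟨0, by omega⟩⟩
  have hcpt : IsCompact (sphere (0 : EuclideanSpace ℝ (Fin n)) 1) := isCompact_sphere _ _
  obtain ⟨x₀, hx₀, hmin⟩ :=
    hcpt.exists_isMinOn (NormedSpace.sphere_nonempty.2 zero_le_one) hf_cont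
  have hm : 0 < f x₀ := hf_pos x₀ hx₀
  obtain ⟨κ, hκ, hcap⟩ := exists_pos_le_hausdorffMeasure_cap hn
  have hfin := hausdorffMeasure_sphere_lt_top hn
  have hcap_fin : ∀ u : EuclideanSpace ℝ (Fin n),
      μH[(n : ℝ) - 1] {x : EuclideanSpace ℝ (Fin n) | x ∈ sphere 0 1 ∧ 1 / 2 ≤ ⟪u, x⟫} < ⊤ :=
    fun u => (measure_mono fun x hx => hx.1).trans_lt hfin
  obtain ⟨u₀, hu₀⟩ := exists_norm_eq (EuclideanSpace ℝ (Fin n)) zero_le_one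
  have hκ' : 0 < κ.toReal := ENNReal.toReal_pos hκ.ne' ((hcap u₀ hu₀).trans_lt (hcap_fin u₀)).ne
  refine ⟨max 1 (2 * (M / (f x₀ * κ.toReal)) ^ p⁻¹), lt_max_of_lt_left one_pos,
    fun Ω hΩ h0 hM y hy => ?_⟩
  rcases eq_or_ne y 0 with rfl | hy0
  · simp
  refine le_max_of_le_right ?_
  have hr : 0 < ‖y‖ := norm_pos_iff.2 hy0
  set u := ‖y‖⁻¹ • y with hu
  have hu1 : ‖u‖ = 1 := norm_smul_inv_norm (𝕜 := ℝ) hy0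
  set c := {x : EuclideanSpace ℝ (Fin n) | x ∈ sphere 0 1 ∧ 1 / 2 ≤ ⟪u, x⟫} with hc
  have hcont : Continuous fun x : EuclideanSpace ℝ (Fin n) => ⟪u, x⟫ := by fun_prop
  have hcm : MeasurableSet c :=
    IsClosed.measurableSet (isClosed_sphere.inter (isClosed_le continuous_const hcont))
  have hnn : ∀ x, 0 ≤ suppFn Ω x := fun x => by
    simpa using inner_le_suppFn hΩ x h0
  have hgc : ContinuousOn (fun x => f x * suppFn Ω x ^ p) (sphere 0 1) :=
    hf_cont.mul ((continuous_suppFn hΩ).continuousOn.rpow_const fun x _ => Or.inr hp.le)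
  obtain ⟨B, hB⟩ := hcpt.exists_bound_of_continuousOn hgc
  have hgi : IntegrableOn (fun x => f x * suppFn Ω x ^ p) (sphere 0 1) μH[(n : ℝ) - 1] :=
    IntegrableOn.of_bound hfin (hgc.aestronglyMeasurable isClosed_sphere.measurableSet) B
      (ae_restrict_of_forall_mem isClosed_sphere.measurableSet hB)
  have hlow : ∀ x ∈ c, f x₀ * (‖y‖ / 2) ^ p ≤ f x * suppFn Ω x ^ p := by
    intro x hx
    have h1 : ‖y‖ / 2 ≤ suppFn Ω x := by
      refine le_trans ?_ (inner_le_suppFn hΩ x hy)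
      have h2 := hx.2
      rw [hu, real_inner_smul_left, real_inner_comm, inv_mul_eq_div, le_div_iff₀ hr] at h2
      linarith
    exact mul_le_mul (hmin hx.1) (Real.rpow_le_rpow (by positivity) h1 hp.le) (by positivity)
      (hf_pos x hx.1).le
  have h1 : f x₀ * (‖y‖ / 2) ^ p * (μH[(n : ℝ) - 1]).real c ≤
      ∫ x in c, f x * suppFn Ω x ^ p ∂μH[(n : ℝ) - 1] :=
    setIntegral_ge_of_const_le_real hcm (hcap_fin u).ne hlow (hgi.mono_set fun x hx => hx.1)
  have h2 : ∫ x in c, f x * suppFn Ω x ^ p ∂μH[(n : ℝ) - 1] ≤ M := by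
    refine (setIntegral_mono_set hgi ?_
      (Filter.Eventually.of_forall fun x hx => hx.1)).trans hM
    exact ae_restrict_of_forall_mem isClosed_sphere.measurableSet fun x hx =>
      mul_nonneg (hf_pos x hx).le (Real.rpow_nonneg (hnn x) _)
  have h3 : κ.toReal ≤ (μH[(n : ℝ) - 1]).real c :=
    ENNReal.toReal_mono (hcap_fin u).ne (hcap u hu1)
  have h4 : f x₀ * (‖y‖ / 2) ^ p * κ.toReal ≤ M :=
    (mul_le_mul_of_nonneg_left h3 (by positivity)).trans (h1.trans h2)
  have h5 : (‖y‖ / 2) ^ p ≤ M / (f x₀ * κ.toReal) := by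
    rw [le_div_iff₀ (by positivity)]
    linarith
  have h6 := Real.rpow_le_rpow (by positivity) h5 (inv_nonneg.2 hp.le)
  rw [Real.rpow_rpow_inv (by positivity) hp.ne'] at h6
  linarith

theorem stmt_2 {n : ℕ} (hn : 2 ≤ n) (p q : ℝ) (hp : 0 < p) (hq : 1 < q)
    (f : EuclideanSpace ℝ (Fin n) → ℝ)
    (hf_cont : ContinuousOn f (sphere (0 : EuclideanSpace ℝ (Fin n)) 1))
    (hf_pos : ∀ x ∈ sphere (0 : EuclideanSpace ℝ (Fin n)) 1, 0 < f x)
    (hf_even : ∀ x : EuclideanSpace ℝ (Fin n), f (-x) = f x)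
    (c₀ M : ℝ) (hc₀ : 0 < c₀) (hM : 0 < M) :
    ∃ C : ℝ, 1 ≤ C ∧
      ∀ Ω : Set (EuclideanSpace ℝ (Fin n)),
        IsCompact Ω → Convex ℝ Ω → (interior Ω).Nonempty → Ω = -Ω →
        c₀ ≤ chordIntegral n q Ω →
        (∫ x in sphere (0 : EuclideanSpace ℝ (Fin n)) 1,
            f x * suppFn Ω x ^ p ∂(μH[(n : ℝ) - 1])) ≤ M →
        ∀ x ∈ sphere (0 : EuclideanSpace ℝ (Fin n)) 1,
          1 / C ≤ suppFn Ω x ∧ suppFn Ω x ≤ C := by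
  obtain ⟨R, hR, hbound⟩ := exists_norm_le_of_setIntegral_suppFn_le hn hp hf_cont hf_pos M
  obtain ⟨K, hK, hchord⟩ := exists_chordIntegral_le_mul_volume (n := n) (by omega) hq R
  set B := K * (2 * (2 * R) ^ (n - 1)) + 1 with hB
  have hB0 : 0 < B := by positivity
  refine ⟨max 1 (max R (B / c₀)), le_max_left _ _, ?_⟩
  intro Ω hΩ hconv hint hsymm hI hM' x hx
  have hx1 : ‖x‖ = 1 := mem_sphere_zero_iff_norm.1 hx
  have hne : Ω.Nonempty := hint.mono interior_subset
  have hneg : ∀ y ∈ Ω, -y ∈ Ω := fun y hy => by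
    rw [hsymm] at hy
    exact hy
  have h0 : (0 : EuclideanSpace ℝ (Fin n)) ∈ Ω := by
    obtain ⟨y, hy⟩ := hne
    simpa using hconv hy (hneg y hy) (a := 1 / 2) (b := 1 / 2) (by norm_num) (by norm_num)
      (by norm_num)
  have hball := hbound Ω hΩ h0 hM'
  set δ := suppFn Ω x with hδ
  have hδ0 : 0 ≤ δ := by simpa using inner_le_suppFn hΩ x h0
  have hvol : volume.real Ω ≤ 2 * δ * (2 * R) ^ (n - 1) := by
    refine volume_real_slab_le (by omega) hx1 hδ0 hR.le fun y hy => ⟨hball y hy, abs_le.2 ⟨?_, ?_⟩⟩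
    · have := inner_le_suppFn hΩ x (hneg y hy)
      rw [inner_neg_right] at this
      linarith
    · exact inner_le_suppFn hΩ x hy
  have hc : c₀ ≤ B * δ := by
    have h1 := hI.trans (hchord Ω fun y hy => mem_closedBall_zero_iff.2 (hball y hy))
    have h2 := mul_le_mul_of_nonneg_left hvol hK
    rw [hB]
    linarith
  constructor
  · calc 1 / max 1 (max R (B / c₀)) ≤ 1 / (B / c₀) :=
          one_div_le_one_div_of_le (by positivity) ((le_max_right _ _).trans (le_max_right _ _))
      _ = c₀ / B := one_div_div _ _
      _ ≤ δ := (div_le_iff₀ hB0).2 (by linarith)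
  · refine (suppFn_le hne fun y hy => ?_).trans ((le_max_left _ _).trans (le_max_right _ _))
    calc ⟪x, y⟫ ≤ ‖x‖ * ‖y‖ := real_inner_le_norm _ _
      _ ≤ R := by simpa [hx1] using hball y hy
end

section
/- Let n ≥ 2, q > 1 and 0 < r ≤ R. There exist constants c, C > 0 depending only on n, q, r, R such that for every convex body Ω ⊂ ℝⁿ with B̄(0,r) ⊆ Ω ⊆ B̄(0,R) and every z ∈ Ω (including boundary points): c ≤ ((q−1)/n)·∫_Ω |y − z|^{q−1−n} dy ≤ C. -/
open MeasureTheory Metric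

/-- The radial power `‖x‖ ^ s` is integrable on balls as soon as `s` exceeds minus the dimension. -/
theorem integrableOn_norm_rpow_ball {n : ℕ} (hn : 1 ≤ n) {s : ℝ} (hs : -(n : ℝ) < s) (ρ : ℝ) :
    IntegrableOn (fun x : EuclideanSpace ℝ (Fin n) ↦ ‖x‖ ^ s) (ball 0 ρ) := by
  have : Nonempty (Fin n) := ⟨⟨0, hn⟩⟩
  rw [integrableOn_fun_norm_addHaar volume (f := fun t : ℝ ↦ t ^ s)]
  have h := (intervalIntegral.integrableOn_Ioo_rpow_iff (s := s + n - 1) (t := max ρ 1)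
    (lt_max_of_lt_right one_pos)).2 (by linarith)
  refine (h.mono_set (Set.Ioo_subset_Ioo_right (le_max_left _ _))).congr_fun ?_ measurableSet_Ioo
  intro y hy
  have hy0 : 0 < y := hy.1
  simp only [finrank_euclideanSpace, Fintype.card_fin, smul_eq_mul]
  rw [← Real.rpow_natCast, ← Real.rpow_add hy0, Nat.cast_sub hn]
  congr 1
  push_cast
  ring

/-- Removing any ball of half the radius leaves a definite part of a ball. -/
theorem measureReal_closedBall_diff_closedBall_ge {n : ℕ} (z : EuclideanSpace ℝ (Fin n)) {r : ℝ}
    (hr : 0 < r) :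
    (r ^ n - (r / 2) ^ n) * volume.real (ball (0 : EuclideanSpace ℝ (Fin n)) 1) ≤
      volume.real (closedBall (0 : EuclideanSpace ℝ (Fin n)) r \ closedBall z (r / 2)) := by
  have h := le_measureReal_sdiff (μ := volume)
    (s₁ := closedBall (0 : EuclideanSpace ℝ (Fin n)) r) (s₂ := closedBall z (r / 2))
    measure_closedBall_lt_top.ne
  rw [Measure.addHaar_real_closedBall _ _ hr.le,
    Measure.addHaar_real_closedBall _ _ (half_pos hr).le, finrank_euclideanSpace,
    Fintype.card_fin] at h
  linarith

theorem stmt_7 {n : ℕ} (hn : 2 ≤ n) (q r R : ℝ) (hq : 1 < q) (hr : 0 < r) (hrR : r ≤ R) :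
    ∃ c C : ℝ, 0 < c ∧ 0 < C ∧
      ∀ Ω : Set (EuclideanSpace ℝ (Fin n)),
        IsCompact Ω → Convex ℝ Ω → (interior Ω).Nonempty →
        closedBall (0 : EuclideanSpace ℝ (Fin n)) r ⊆ Ω →
        Ω ⊆ closedBall (0 : EuclideanSpace ℝ (Fin n)) R →
        ∀ z ∈ Ω,
          c ≤ ((q - 1) / (n : ℝ)) * ∫ y in Ω, ‖y - z‖ ^ (q - 1 - (n : ℝ)) ∧
          ((q - 1) / (n : ℝ)) * (∫ y in Ω, ‖y - z‖ ^ (q - 1 - (n : ℝ))) ≤ C := by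
  have hR : 0 < R := hr.trans_le hrR
  have hn0 : (0 : ℝ) < n := by exact_mod_cast (by omega : 0 < n)
  have hK : 0 < (q - 1) / (n : ℝ) := div_pos (by linarith) hn0
  set s : ℝ := q - 1 - n
  have hint := integrableOn_norm_rpow_ball (n := n) (by omega) (s := s) (by linarith) (3 * R)
  set B := ball (0 : EuclideanSpace ℝ (Fin n)) (3 * R) with hB
  set I := ∫ x in B, ‖x‖ ^ s
  have hI0 : 0 ≤ I := integral_nonneg fun x ↦ by positivity
  set v := (r ^ n - (r / 2) ^ n) * volume.real (ball (0 : EuclideanSpace ℝ (Fin n)) 1)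
  have hv0 : 0 < v := by
    refine mul_pos (sub_pos.2 (pow_lt_pow_left₀ (by linarith) (by linarith) (by omega))) ?_
    exact ENNReal.toReal_pos (measure_ball_pos _ _ one_pos).ne' measure_ball_lt_top.ne
  set m := min ((r / 2) ^ s) ((2 * R) ^ s)
  have hm0 : 0 < m := lt_min (by positivity) (by positivity)
  refine ⟨(q - 1) / n * (m * v), (q - 1) / n * (I + 1), by positivity, by positivity, ?_⟩
  intro Ω hΩ _ _ hrΩ hΩR z hz
  have hzR : ‖z‖ ≤ R := by simpa using hΩR hz
  have hdist : ∀ y ∈ Ω, ‖y - z‖ ≤ 2 * R := fun y hy ↦ by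
    have : ‖y‖ ≤ R := by simpa using hΩR hy
    linarith [norm_sub_le y z]
  have hint' : Integrable (fun y ↦ B.indicator (fun x ↦ ‖x‖ ^ s) (y - z)) :=
    ((integrable_indicator_iff measurableSet_ball).2 hint).comp_sub_right z
  have heq : ∀ y ∈ Ω, B.indicator (fun x ↦ ‖x‖ ^ s) (y - z) = ‖y - z‖ ^ s := fun y hy ↦
    Set.indicator_of_mem (by simpa [hB] using (hdist y hy).trans_lt (by linarith)) _
  have hΩint : IntegrableOn (fun y ↦ ‖y - z‖ ^ s) Ω :=
    hint'.integrableOn.congr_fun heq hΩ.measurableSet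
  refine ⟨mul_le_mul_of_nonneg_left ?_ hK.le, mul_le_mul_of_nonneg_left ?_ hK.le⟩
  · set A := closedBall (0 : EuclideanSpace ℝ (Fin n)) r \ closedBall z (r / 2)
    have hAΩ : A ⊆ Ω := Set.sdiff_subset.trans hrΩ
    have hlow : ∀ y ∈ A, m ≤ ‖y - z‖ ^ s := fun y hy ↦ by
      have h1 : r / 2 ≤ ‖y - z‖ := by
        have := hy.2
        rw [mem_closedBall, dist_eq_norm] at this
        exact (not_le.1 this).le
      have h2 := hdist y (hAΩ hy)
      rcases le_total 0 s with h | h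
      · exact (min_le_left _ _).trans (Real.rpow_le_rpow (by positivity) h1 h)
      · exact (min_le_right _ _).trans
          (Real.rpow_le_rpow_of_nonpos ((half_pos hr).trans_le h1) h2 h)
    calc m * v ≤ m * volume.real A :=
          mul_le_mul_of_nonneg_left (measureReal_closedBall_diff_closedBall_ge z hr) hm0.le
      _ ≤ ∫ y in A, ‖y - z‖ ^ s :=
          setIntegral_ge_of_const_le_real (measurableSet_closedBall.diff measurableSet_closedBall)
            ((measure_mono Set.sdiff_subset).trans_lt measure_closedBall_lt_top).ne hlow
            (hΩint.mono_set hAΩ)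
      _ ≤ ∫ y in Ω, ‖y - z‖ ^ s :=
          setIntegral_mono_set hΩint (.of_forall fun y ↦ by positivity) hAΩ.eventuallyLE
  · calc ∫ y in Ω, ‖y - z‖ ^ s = ∫ y in Ω, B.indicator (fun x ↦ ‖x‖ ^ s) (y - z) :=
          (setIntegral_congr_fun hΩ.measurableSet heq).symm
      _ ≤ ∫ y, B.indicator (fun x ↦ ‖x‖ ^ s) (y - z) :=
          setIntegral_le_integral hint'
            (.of_forall fun y ↦ Set.indicator_nonneg (fun x _ ↦ by positivity) _)
      _ = I := by
          rw [integral_sub_right_eq_self (fun x ↦ B.indicator (fun x ↦ ‖x‖ ^ s) x) z,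
            integral_indicator measurableSet_ball]
      _ ≤ I + 1 := by linarith
end

section
/- Let n ≥ 2 and q > 1. If (Ω_k) is a sequence of convex bodies in ℝⁿ converging in the Hausdorff metric to a convex body Ω (with nonempty interior), then I_q(Ω_k) → I_q(Ω) as k → ∞. -/
open MeasureTheory Metric Filter

open scoped Topology

/-- Dominated convergence for integrals over varying sets. -/
theorem tendsto_setIntegral_of_ae_eventually_mem_iff {α : Type*} [MeasurableSpace α]
    {μ : Measure α} {s : ℕ → Set α} {s₀ K : Set α} {g : ℕ → α → ℝ} {g₀ bound : α → ℝ}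
    (hs : ∀ k, MeasurableSet (s k)) (hs₀ : MeasurableSet s₀) (hK : MeasurableSet K)
    (hsK : ∀ᶠ k in atTop, s k ⊆ K)
    (hmem : ∀ᵐ x ∂μ, ∀ᶠ k in atTop, (x ∈ s k ↔ x ∈ s₀))
    (hg : ∀ k, AEStronglyMeasurable (g k) μ) (hbound : IntegrableOn bound K μ)
    (hle : ∀ᶠ k in atTop, ∀ x ∈ K, ‖g k x‖ ≤ bound x)
    (hlim : ∀ x, Tendsto (fun k => g k x) atTop (𝓝 (g₀ x))) :
    Tendsto (fun k => ∫ x in s k, g k x ∂μ) atTop (𝓝 (∫ x in s₀, g₀ x ∂μ)) := by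
  simp_rw [← integral_indicator (hs _), ← integral_indicator hs₀]
  refine tendsto_integral_filter_of_dominated_convergence (K.indicator bound)
    (Eventually.of_forall fun k => (hg k).indicator (hs k)) ?_
    (hbound.integrable_indicator hK) ?_
  · filter_upwards [hsK, hle] with k hk hlek
    refine Eventually.of_forall fun x => ?_
    by_cases hx : x ∈ s k
    · simpa [hx, hk hx] using hlek x (hk hx)
    · by_cases hxK : x ∈ K
      · simpa [hx, hxK] using (norm_nonneg _).trans (hlek x hxK)
      · simp [hx, hxK]
  · filter_upwards [hmem] with x hx
    by_cases hx₀ : x ∈ s₀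
    · rw [Set.indicator_of_mem hx₀]
      refine (hlim x).congr' ?_
      filter_upwards [hx] with k hk
      rw [Set.indicator_of_mem (hk.2 hx₀)]
    · rw [Set.indicator_of_notMem hx₀]
      refine tendsto_const_nhds.congr' ?_
      filter_upwards [hx] with k hk
      rw [Set.indicator_of_notMem (mt hk.1 hx₀)]

/-- Double integrals of a locally integrable difference kernel are continuous along uniformly
bounded sequences of sets converging almost everywhere. -/
theorem tendsto_setIntegral_setIntegral_sub {E : Type*} [NormedAddCommGroup E]
    [NormedSpace ℝ E] [FiniteDimensional ℝ E] [MeasurableSpace E] [BorelSpace E]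
    {μ : Measure E} [μ.IsAddHaarMeasure] {f : E → ℝ} (hf : Measurable f)
    (hfi : LocallyIntegrable f μ) {s : ℕ → Set E} {s₀ : Set E} {R : ℝ}
    (hs : ∀ k, MeasurableSet (s k)) (hs₀ : MeasurableSet s₀)
    (hsR : ∀ᶠ k in atTop, s k ⊆ closedBall 0 R)
    (hmem : ∀ᵐ x ∂μ, ∀ᶠ k in atTop, (x ∈ s k ↔ x ∈ s₀)) :
    Tendsto (fun k => ∫ z in s k, ∫ y in s k, f (y - z) ∂μ ∂μ) atTop
      (𝓝 (∫ z in s₀, ∫ y in s₀, f (y - z) ∂μ ∂μ)) := by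
  have : ProperSpace E := FiniteDimensional.proper ℝ E
  have hball (z : E) (r : ℝ) : IntegrableOn (fun y => f (y - z)) (closedBall z r) μ := by
    have h := (measurePreserving_sub_right μ z).integrableOn_comp_preimage
      (MeasurableEquiv.subRight z).measurableEmbedding (f := f) (s := closedBall 0 r)
    have hpre : (fun y => y - z) ⁻¹' closedBall 0 r = closedBall z r := by
      ext y; simp [dist_eq_norm]
    rw [hpre] at h
    exact h.2 (hfi.integrableOn_isCompact (isCompact_closedBall 0 r))
  have hsub {z : E} (hz : z ∈ closedBall (0 : E) R) :
      closedBall (0 : E) R ⊆ closedBall z (2 * R) := by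
    intro y hy
    simp only [mem_closedBall, dist_zero_right] at hy hz ⊢
    rw [dist_eq_norm]
    linarith [norm_sub_le y z]
  have hnorm (z : E) (r : ℝ) :
      ∫ y in closedBall z r, ‖f (y - z)‖ ∂μ = ∫ y in closedBall 0 r, ‖f y‖ ∂μ := by
    have h := (measurePreserving_sub_right μ z).setIntegral_preimage_emb
      (MeasurableEquiv.subRight z).measurableEmbedding (fun y => ‖f y‖) (closedBall 0 r)
    have hpre : (fun y => y - z) ⁻¹' closedBall 0 r = closedBall z r := by
      ext y; simp [dist_eq_norm]
    rwa [hpre] at h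
  refine tendsto_setIntegral_of_ae_eventually_mem_iff (K := closedBall 0 R)
    (bound := fun _ => ∫ y in closedBall 0 (2 * R), ‖f y‖ ∂μ) hs hs₀ measurableSet_closedBall
    hsR hmem (fun k => ?_) (integrableOn_const measure_closedBall_lt_top.ne) ?_ fun z => ?_
  · have hm : StronglyMeasurable (Function.uncurry fun z y : E => f (y - z)) :=
      (hf.comp (measurable_snd.sub measurable_fst)).stronglyMeasurable
    exact (hm.integral_prod_right (ν := μ.restrict (s k))).aestronglyMeasurable
  · filter_upwards [hsR] with k hk z hz
    calc ‖∫ y in s k, f (y - z) ∂μ‖ ≤ ∫ y in s k, ‖f (y - z)‖ ∂μ :=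
          norm_integral_le_integral_norm _
      _ ≤ ∫ y in closedBall z (2 * R), ‖f (y - z)‖ ∂μ :=
          setIntegral_mono_set (hball z _).norm
            (Eventually.of_forall fun y => norm_nonneg _) (hk.trans (hsub hz)).eventuallyLE
      _ = _ := hnorm z _
  · refine tendsto_setIntegral_of_ae_eventually_mem_iff (K := closedBall 0 R)
      (bound := fun y => ‖f (y - z)‖) hs hs₀ measurableSet_closedBall hsR hmem
      (fun k => (hf.comp (measurable_id.sub_const z)).aestronglyMeasurable) ?_
      (Eventually.of_forall fun k x _ => le_rfl) fun x => tendsto_const_nhds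
    refine IntegrableOn.mono_set (hball z (R + ‖z‖)).norm fun y hy => ?_
    simp only [mem_closedBall, dist_zero_right] at hy ⊢
    rw [dist_eq_norm]
    linarith [norm_sub_le y z]

/-- A closed convex set at Hausdorff distance less than `r` from `t` contains the centre of every
closed ball of radius `r` contained in `t`. -/
theorem mem_of_hausdorffDist_lt_of_closedBall_subset {E : Type*} [NormedAddCommGroup E]
    [InnerProductSpace ℝ E] [CompleteSpace E] {s t : Set E} {z : E} {r : ℝ}
    (hs : Convex ℝ s) (hsc : IsClosed s) (hr : hausdorffDist s t < r)
    (hfin : hausdorffEDist s t ≠ ⊤) (hball : closedBall z r ⊆ t) : z ∈ s := by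
  by_contra hz
  have hr₀ : 0 < r := hausdorffDist_nonneg.trans_lt hr
  obtain ⟨φ, u, hφs, hφz⟩ := geometric_hahn_banach_closed_point hs hsc hz
  obtain ⟨v, rfl⟩ := (InnerProductSpace.toDual ℝ E).surjective φ
  simp only [InnerProductSpace.toDual_apply_apply] at hφs hφz
  obtain ⟨y₀, hy₀, -⟩ := exists_dist_lt_of_hausdorffDist_lt'
    (hball (mem_closedBall_self hr₀.le)) hr hfin
  have hv : 0 < ‖v‖ := by
    refine norm_pos_iff.2 fun hv => ?_
    have h := (hφs y₀ hy₀).trans hφz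
    simp [hv] at h
  have hw : z + (r / ‖v‖) • v ∈ t := hball <| by
    simp [norm_smul, abs_of_pos hr₀, hv.ne']
  obtain ⟨y, hy, hyw⟩ := exists_dist_lt_of_hausdorffDist_lt' hw hr hfin
  rw [dist_comm, dist_eq_norm] at hyw
  have h₁ := real_inner_le_norm v (z + (r / ‖v‖) • v - y)
  have h₂ : inner ℝ v (z + (r / ‖v‖) • v - y) = inner ℝ v z + r * ‖v‖ - inner ℝ v y := by
    rw [inner_sub_right, inner_add_right, inner_smul_right, real_inner_self_eq_norm_sq]
    field_simp
  have h₃ := mul_lt_mul_of_pos_left hyw hv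
  linarith [(hφs y hy).trans hφz]

/-- Convex bodies converging in the Hausdorff metric converge pointwise off the frontier of the
limit. -/
theorem eventually_mem_iff_of_tendsto_hausdorffDist {E : Type*} [NormedAddCommGroup E]
    [InnerProductSpace ℝ E] [CompleteSpace E] {s : ℕ → Set E} {s₀ : Set E}
    (hs : ∀ k, Convex ℝ (s k)) (hsc : ∀ k, IsClosed (s k)) (hs₀ : IsClosed s₀)
    (hne : s₀.Nonempty) (hfin : ∀ k, hausdorffEDist (s k) s₀ ≠ ⊤)
    (hconv : Tendsto (fun k => hausdorffDist (s k) s₀) atTop (𝓝 0)) {z : E}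
    (hz : z ∉ frontier s₀) : ∀ᶠ k in atTop, (z ∈ s k ↔ z ∈ s₀) := by
  by_cases hz₀ : z ∈ s₀
  · have hint : z ∈ interior s₀ := by
      by_contra h
      exact hz ⟨subset_closure hz₀, h⟩
    obtain ⟨r, hr, hball⟩ := nhds_basis_closedBall.mem_iff.1 (mem_interior_iff_mem_nhds.1 hint)
    filter_upwards [hconv.eventually_lt_const hr] with k hk
    exact iff_of_true
      (mem_of_hausdorffDist_lt_of_closedBall_subset (hs k) (hsc k) hk (hfin k) hball) hz₀
  · have hpos : 0 < infDist z s₀ := (hs₀.notMem_iff_infDist_pos hne).1 hz₀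
    filter_upwards [hconv.eventually_lt_const hpos] with k hk
    exact iff_of_false
      (fun h => (infDist_le_hausdorffDist_of_mem h (hfin k)).not_gt hk) hz₀

theorem stmt_18 {n : ℕ} (hn : 2 ≤ n) (q : ℝ) (hq : 1 < q)
    (Ω : ℕ → Set (EuclideanSpace ℝ (Fin n))) (Ω₀ : Set (EuclideanSpace ℝ (Fin n)))
    (hbody : ∀ k, IsCompact (Ω k) ∧ Convex ℝ (Ω k) ∧ (interior (Ω k)).Nonempty)
    (hbody₀ : IsCompact Ω₀ ∧ Convex ℝ Ω₀ ∧ (interior Ω₀).Nonempty)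
    (hconv : Tendsto (fun k => Metric.hausdorffDist (Ω k) Ω₀) atTop (nhds 0)) :
    Tendsto (fun k => chordIntegral n q (Ω k)) atTop (nhds (chordIntegral n q Ω₀)) := by
  have hne₀ : Ω₀.Nonempty := hbody₀.2.2.mono interior_subset
  have hfin (k : ℕ) : hausdorffEDist (Ω k) Ω₀ ≠ ⊤ :=
    hausdorffEDist_ne_top_of_nonempty_of_bounded ((hbody k).2.2.mono interior_subset) hne₀
      (hbody k).1.isBounded hbody₀.1.isBounded
  obtain ⟨R, hR⟩ := hbody₀.1.isBounded.subset_closedBall (0 : EuclideanSpace ℝ (Fin n))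
  have hbdd : ∀ᶠ k in atTop, Ω k ⊆ closedBall 0 (R + 1) := by
    filter_upwards [hconv.eventually_lt_const one_pos] with k hk x hx
    obtain ⟨y, hy, hxy⟩ := exists_dist_lt_of_hausdorffDist_lt hx hk (hfin k)
    have := mem_closedBall.1 (hR hy)
    rw [mem_closedBall]
    linarith [dist_triangle x y 0]
  have hmeas : Measurable fun x : EuclideanSpace ℝ (Fin n) => ‖x‖ ^ (q - 1 - (n : ℝ)) :=
    measurable_norm.pow_const _
  have hloc : LocallyIntegrable
      (fun x : EuclideanSpace ℝ (Fin n) => ‖x‖ ^ (q - 1 - (n : ℝ))) volume := by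
    refine locallyIntegrable_of_norm_le_rpow (C := 1) (α := (n : ℝ) - (q - 1))
      (by simp; omega) (by simp; linarith) (Eventually.of_forall fun x => ?_)
      hmeas.aestronglyMeasurable
    rw [Real.norm_of_nonneg (by positivity), one_mul, neg_sub]
  refine (tendsto_setIntegral_setIntegral_sub hmeas hloc (fun k => (hbody k).1.measurableSet)
    hbody₀.1.measurableSet hbdd ?_).const_mul _
  filter_upwards [measure_eq_zero_iff_ae_notMem.1 (hbody₀.2.1.addHaar_frontier volume)] with z hz
  exact eventually_mem_iff_of_tendsto_hausdorffDist (fun k => (hbody k).2.1)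
    (fun k => (hbody k).1.isClosed) hbody₀.1.isClosed hne₀ hfin hconv hz
end
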